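/- arXiv:2205.12703 — 2 statements merged into one kernel-verified Lean document; each statement's English description precedes it below -/
import Mathlib

section
/- Let C be a positive prevariety of languages over a finite alphabet A and let α : A* → M be a surjective monoid morphism into a finite monoid. The following are equivalent: (1) α⁻¹(F) belongs to Pol(C) ∩ coPol(C) for every F ⊆ M; (2) s^{ω+1} = s^ω t s^ω for every C-pair (s,t) ∈ M × M for α; (3) s^{ω+1} = s^ω t s^ω for all s, t ∈ M with s ≼_C t. -/
/- Common definitions: languages over a finite alphabet, classes of languages,
prevarieties, polynomial closure and its variants, separation, C-pairs, etc. -/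

namespace RegLang

variable {A : Type}

/-- A language over the alphabet `A`: a set of finite words. -/
abbrev Lang (A : Type) := Set (FreeMonoid A)

/-- A class of languages over the alphabet `A`. -/
abbrev LangClass (A : Type) := Set (Lang A)

/-- A lattice of languages: contains `∅` and `A*` and is closed under binary
union and intersection. -/
def IsLatticeClass (C : LangClass A) : Prop :=
  ∅ ∈ C ∧ (Set.univ : Lang A) ∈ C ∧
    (∀ K L : Lang A, K ∈ C → L ∈ C → K ∪ L ∈ C) ∧
    (∀ K L : Lang A, K ∈ C → L ∈ C → K ∩ L ∈ C)

/-- A Boolean algebra of languages: a lattice of languages closed under complement. -/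
def IsBooleanAlgebraClass (C : LangClass A) : Prop :=
  IsLatticeClass C ∧ ∀ L ∈ C, Lᶜ ∈ C

/-- A class is quotient-closed if it is closed under left and right quotients by words. -/
def QuotientClosed (C : LangClass A) : Prop :=
  ∀ L ∈ C, ∀ u : FreeMonoid A,
    {w : FreeMonoid A | u * w ∈ L} ∈ C ∧ {w : FreeMonoid A | w * u ∈ L} ∈ C

/-- A language is regular if it is a preimage of a subset under a monoid morphism
into a finite monoid. -/
def IsRegularLang (L : Lang A) : Prop :=
  ∃ (M : Type) (_ : Monoid M) (_ : Finite M) (φ : FreeMonoid A →* M) (F : Set M),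
    L = φ ⁻¹' F

/-- A positive prevariety: a quotient-closed lattice of regular languages. -/
def IsPositivePrevariety (C : LangClass A) : Prop :=
  IsLatticeClass C ∧ QuotientClosed C ∧ ∀ L ∈ C, IsRegularLang L

/-- A prevariety: a quotient-closed Boolean algebra of regular languages. -/
def IsPrevariety (C : LangClass A) : Prop :=
  IsBooleanAlgebraClass C ∧ QuotientClosed C ∧ ∀ L ∈ C, IsRegularLang L

/-- The marked concatenation `KaL = {uav : u ∈ K, v ∈ L}`. -/
def MarkedCat (K : Lang A) (a : A) (L : Lang A) : Lang A :=
  {w | ∃ u ∈ K, ∃ v ∈ L, w = u * FreeMonoid.of a * v}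

/-- A marked concatenation `KaL` is unambiguous if every word of `KaL` has a
unique factorization `uav` with `u ∈ K` and `v ∈ L`. -/
def Unambiguous (K : Lang A) (a : A) (L : Lang A) : Prop :=
  ∀ u u' v v' : FreeMonoid A, u ∈ K → u' ∈ K → v ∈ L → v' ∈ L →
    u * FreeMonoid.of a * v = u' * FreeMonoid.of a * v' → u = u' ∧ v = v'

/-- The marked concatenation `KaL` is left deterministic: `K ∩ KaA* = ∅`. -/
def LeftDeterministic (K : Lang A) (a : A) (_L : Lang A) : Prop :=
  K ∩ MarkedCat K a Set.univ = ∅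

/-- The marked concatenation `KaL` is right deterministic: `L ∩ A*aL = ∅`. -/
def RightDeterministic (_K : Lang A) (a : A) (L : Lang A) : Prop :=
  L ∩ MarkedCat Set.univ a L = ∅

/-- Polynomial closure: the least class containing `C` and closed under binary
union and marked concatenation. -/
inductive Pol (C : LangClass A) : Lang A → Prop
  | base {L : Lang A} : L ∈ C → Pol C L
  | union {K L : Lang A} : Pol C K → Pol C L → Pol C (K ∪ L)
  | mcat {K L : Lang A} (a : A) : Pol C K → Pol C L → Pol C (MarkedCat K a L)

/-- `coPol C`: the class of complements of languages in `Pol C`. -/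
def coPol (C : LangClass A) : LangClass A := {L | ∃ K : Lang A, Pol C K ∧ L = Kᶜ}

/-- `BPol C`: the least Boolean algebra of languages containing `Pol C`. -/
inductive BPol (C : LangClass A) : Lang A → Prop
  | base {L : Lang A} : Pol C L → BPol C L
  | empty : BPol C ∅
  | univ : BPol C Set.univ
  | union {K L : Lang A} : BPol C K → BPol C L → BPol C (K ∪ L)
  | inter {K L : Lang A} : BPol C K → BPol C L → BPol C (K ∩ L)
  | compl {L : Lang A} : BPol C L → BPol C Lᶜ

/-- Unambiguous polynomial closure: the least class containing `C` and closed
under disjoint union and unambiguous marked concatenation. -/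
inductive UPol (C : LangClass A) : Lang A → Prop
  | base {L : Lang A} : L ∈ C → UPol C L
  | disjUnion {K L : Lang A} : UPol C K → UPol C L → K ∩ L = ∅ → UPol C (K ∪ L)
  | mcat {K L : Lang A} (a : A) : UPol C K → UPol C L → Unambiguous K a L →
      UPol C (MarkedCat K a L)

/-- Alternated polynomial closure: the least class containing `C` and closed under
disjoint union and left- and right-deterministic marked concatenation. -/
inductive APol (C : LangClass A) : Lang A → Prop
  | base {L : Lang A} : L ∈ C → APol C L
  | disjUnion {K L : Lang A} : APol C K → APol C L → K ∩ L = ∅ → APol C (K ∪ L)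
  | leftCat {K L : Lang A} (a : A) : APol C K → APol C L → LeftDeterministic K a L →
      APol C (MarkedCat K a L)
  | rightCat {K L : Lang A} (a : A) : APol C K → APol C L → RightDeterministic K a L →
      APol C (MarkedCat K a L)

/-- `KaL` is left `C`-deterministic: there are `K', L' ∈ C` with `K ⊆ K'`, `L ⊆ L'`
and `K'aL'` left deterministic. -/
def LeftCDeterministic (C : LangClass A) (K : Lang A) (a : A) (L : Lang A) : Prop :=
  ∃ K' ∈ C, ∃ L' ∈ C, K ⊆ K' ∧ L ⊆ L' ∧ LeftDeterministic K' a L'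

/-- `KaL` is right `C`-deterministic: there are `K', L' ∈ C` with `K ⊆ K'`, `L ⊆ L'`
and `K'aL'` right deterministic. -/
def RightCDeterministic (C : LangClass A) (K : Lang A) (a : A) (L : Lang A) : Prop :=
  ∃ K' ∈ C, ∃ L' ∈ C, K ⊆ K' ∧ L ⊆ L' ∧ RightDeterministic K' a L'

/-- Weak alternated polynomial closure: the least class containing `C` and closed under
disjoint union and left- and right-`C`-deterministic marked concatenation. -/
inductive WAPol (C : LangClass A) : Lang A → Prop
  | base {L : Lang A} : L ∈ C → WAPol C L
  | disjUnion {K L : Lang A} : WAPol C K → WAPol C L → K ∩ L = ∅ → WAPol C (K ∪ L)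
  | leftCat {K L : Lang A} (a : A) : WAPol C K → WAPol C L →
      LeftCDeterministic C K a L → WAPol C (MarkedCat K a L)
  | rightCat {K L : Lang A} (a : A) : WAPol C K → WAPol C L →
      RightCDeterministic C K a L → WAPol C (MarkedCat K a L)

/-- `K` separates `L₁` from `L₂`. -/
def Separates (K L₁ L₂ : Lang A) : Prop := L₁ ⊆ K ∧ K ∩ L₂ = ∅

/-- `L₁` is `C`-separable from `L₂`. -/
def Separable (C : LangClass A) (L₁ L₂ : Lang A) : Prop := ∃ K ∈ C, Separates K L₁ L₂

/-- `(s, t)` is a `C`-pair for `φ`: `φ⁻¹(s)` is not `C`-separable from `φ⁻¹(t)`. -/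
def CPair (C : LangClass A) {M : Type} [Monoid M] (φ : FreeMonoid A →* M)
    (s t : M) : Prop :=
  ¬ Separable C (φ ⁻¹' {s}) (φ ⁻¹' {t})

/-- The canonical `C`-preorder on `M` associated with `φ`. -/
def CPreorder (C : LangClass A) {M : Type} [Monoid M] (φ : FreeMonoid A →* M)
    (s t : M) : Prop :=
  ∀ F : Set M, φ ⁻¹' F ∈ C → s ∈ F → t ∈ F

/-- The canonical `C`-equivalence on `M` associated with `φ`. -/
def CEquiv (C : LangClass A) {M : Type} [Monoid M] (φ : FreeMonoid A →* M)
    (s t : M) : Prop :=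
  ∀ F : Set M, φ ⁻¹' F ∈ C → (s ∈ F ↔ t ∈ F)

/-- A `C`-morphism: a surjective morphism all of whose recognized languages are in `C`. -/
def IsCMorphism (C : LangClass A) {N : Type} [Monoid N] (η : FreeMonoid A →* N) : Prop :=
  Function.Surjective η ∧ ∀ F : Set N, η ⁻¹' F ∈ C

/-- `e` is the idempotent power `s^ω` of `s`: an idempotent of the form `s^n`, `n ≥ 1`
(in a finite monoid such an element exists and is unique). -/
def IsIdempotentPower {M : Type} [Monoid M] (s e : M) : Prop :=
  IsIdempotentElem e ∧ ∃ n : ℕ, 1 ≤ n ∧ e = s ^ n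

/-- The `C`-kernel of `φ`: the elements `s` such that `{ε}` is not `C`-separable
from `φ⁻¹(s)`. -/
def gKernel (C : LangClass A) {M : Type} [Monoid M] (φ : FreeMonoid A →* M) : Set M :=
  {s | ¬ Separable C ({1} : Lang A) (φ ⁻¹' {s})}

/-- The strict `C`-kernel of `φ`: the intersection of the `C`-kernel with `φ(A⁺)`. -/
def strictGKernel (C : LangClass A) {M : Type} [Monoid M]
    (φ : FreeMonoid A →* M) : Set M :=
  gKernel C φ ∩ φ '' {w : FreeMonoid A | w ≠ 1}

/-- A group language: one recognized by a morphism into a finite group. -/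
def IsGroupLanguage (L : Lang A) : Prop :=
  ∃ (G : Type) (_ : Group G) (_ : Finite G) (φ : FreeMonoid A →* G) (F : Set G),
    L = φ ⁻¹' F

/-- A prevariety of group languages. -/
def IsGroupPrevariety (G : LangClass A) : Prop :=
  IsPrevariety G ∧ ∀ L ∈ G, IsGroupLanguage L

/-- The well-suited extension `G⁺`: all languages `L ∩ A⁺` and `L ∪ {ε}` for `L ∈ G`. -/
def wellSuited (G : LangClass A) : LangClass A :=
  {L | ∃ K ∈ G, L = K ∩ {w : FreeMonoid A | w ≠ 1} ∨ L = K ∪ ({1} : Lang A)}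

/-- `le` is a partial order on the monoid `N` compatible with multiplication. -/
def IsCompatiblePartialOrder {N : Type} [Monoid N] (le : N → N → Prop) : Prop :=
  (∀ x, le x x) ∧ (∀ x y z, le x y → le y z → le x z) ∧
    (∀ x y, le x y → le y x → x = y) ∧
    (∀ x x' y y', le x y → le x' y' → le (x * x') (y * y'))

/-- `F` is upward closed for the relation `le`. -/
def UpClosed {N : Type} (le : N → N → Prop) (F : Set N) : Prop :=
  ∀ s ∈ F, ∀ t, le s t → t ∈ F

/-- An ordered `C`-morphism: a surjective morphism onto a finite ordered monoid such
that preimages of upward closed sets are in `C`. -/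
def IsOrderedCMorphism (C : LangClass A) {N : Type} [Monoid N]
    (η : FreeMonoid A →* N) (le : N → N → Prop) : Prop :=
  Function.Surjective η ∧ IsCompatiblePartialOrder le ∧
    ∀ F : Set N, UpClosed le F → η ⁻¹' F ∈ C

/-- The syntactic preorder of `L`: `u ≼_L v` iff `xuy ∈ L → xvy ∈ L` for all `x, y`. -/
def SynPre (L : Lang A) (u v : FreeMonoid A) : Prop :=
  ∀ x y : FreeMonoid A, x * u * y ∈ L → x * v * y ∈ L

/-- `φ` is (a copy of) the syntactic morphism of `L`: it is surjective and identifies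
exactly the words that are syntactically congruent for `L`. -/
def IsSyntacticMorphism (L : Lang A) {M : Type} [Monoid M]
    (φ : FreeMonoid A →* M) : Prop :=
  Function.Surjective φ ∧
    ∀ u v : FreeMonoid A, φ u = φ v ↔ ∀ x y : FreeMonoid A, (x * u * y ∈ L ↔ x * v * y ∈ L)

/-- `le` is (a copy of) the syntactic order of `L` on the target of `φ`. -/
def IsSyntacticOrder (L : Lang A) {M : Type} [Monoid M] (φ : FreeMonoid A →* M)
    (le : M → M → Prop) : Prop :=
  ∀ u v : FreeMonoid A, le (φ u) (φ v) ↔ SynPre L u v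

/-! ### Finite unions and intersections -/

lemma IsLatticeClass.sUnion_mem {C : LangClass A} (hC : IsLatticeClass C) {S : Set (Lang A)}
    (hS : S.Finite) (h : S ⊆ C) : ⋃₀ S ∈ C := by
  induction S, hS using Set.Finite.induction_on with
  | empty => simpa using hC.1
  | insert _ _ ih =>
    rw [Set.sUnion_insert]
    exact hC.2.2.1 _ _ (h (Set.mem_insert _ _)) (ih ((Set.subset_insert _ _).trans h))

lemma IsLatticeClass.sInter_mem {C : LangClass A} (hC : IsLatticeClass C) {S : Set (Lang A)}
    (hS : S.Finite) (h : S ⊆ C) : ⋂₀ S ∈ C := by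
  induction S, hS using Set.Finite.induction_on with
  | empty => simpa using hC.2.1
  | insert _ _ ih =>
    rw [Set.sInter_insert]
    exact hC.2.2.2 _ _ (h (Set.mem_insert _ _)) (ih ((Set.subset_insert _ _).trans h))

lemma Pol.sUnion {C : LangClass A} (hC : IsLatticeClass C) {S : Set (Lang A)}
    (hS : S.Finite) (h : ∀ L ∈ S, Pol C L) : Pol C (⋃₀ S) := by
  induction S, hS using Set.Finite.induction_on with
  | empty => simpa using Pol.base hC.1
  | insert _ _ ih =>
    rw [Set.sUnion_insert]
    exact (h _ (Set.mem_insert _ _)).union (ih fun L hL => h L (Set.mem_insert_of_mem _ hL))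

/-- A language covered by languages of `Pol C` taken from a finite family belongs to `Pol C`. -/
lemma Pol.of_finite_cover {C : LangClass A} (hC : IsLatticeClass C) {S : Set (Lang A)}
    (hS : S.Finite) {L : Lang A} (h : ∀ w ∈ L, ∃ K ∈ S, Pol C K ∧ w ∈ K ∧ K ⊆ L) : Pol C L := by
  have hL : L = ⋃₀ {K ∈ S | Pol C K ∧ K ⊆ L} := by
    apply Set.Subset.antisymm
    · intro w hw
      obtain ⟨K, hK, hp, hwK, hKL⟩ := h w hw
      exact ⟨K, ⟨hK, hp, hKL⟩, hwK⟩
    · rintro w ⟨K, ⟨-, -, hKL⟩, hwK⟩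
      exact hKL hwK
  rw [hL]
  exact Pol.sUnion hC (hS.subset fun K hK => hK.1) fun K hK => hK.2.1

/-! ### Words of a `Pol C` language containing many copies of a block -/

/-- The words `u` and `v` satisfy: replacing an occurrence of `u` by `v` never leaves a
language of the family `S`. -/
def Replaceable (S : Set (Lang A)) (u v : FreeMonoid A) : Prop :=
  ∀ K ∈ S, SynPre K u v

lemma factor_before_or_after {x B y p q : FreeMonoid A} {a : A} {m n : ℕ}
    (h : x * B ^ (m + n) * y = p * FreeMonoid.of a * q) :
    (∃ p', p = x * B ^ m * p' ∧ B ^ n * y = p' * FreeMonoid.of a * q) ∨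
    (∃ q', q = q' * B ^ n * y ∧ x * B ^ m = p * FreeMonoid.of a * q') := by
  have h' : (x * B ^ m) * (B ^ n * y) = p * (FreeMonoid.of a * q) := by
    simpa only [pow_add, mul_assoc] using h
  rcases List.append_eq_append_iff.1 h' with ⟨p', h1, h2⟩ | ⟨r, h1, h2⟩
  · refine Or.inl ⟨FreeMonoid.ofList p', h1, ?_⟩
    rw [mul_assoc]; exact h2
  · cases r with
    | nil =>
      refine Or.inl ⟨1, ?_, ?_⟩
      · rw [mul_one, show x * B ^ m = p * 1 from h1, mul_one]
      · rw [one_mul, show FreeMonoid.of a * q = 1 * (B ^ n * y) from h2, one_mul]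
    | cons b r =>
      obtain ⟨hb, hr⟩ := List.cons_eq_cons.1 (show a :: FreeMonoid.toList q = b :: (r ++ _) from h2)
      subst hb
      refine Or.inr ⟨FreeMonoid.ofList r, ?_, ?_⟩
      · rw [mul_assoc]; exact hr
      · rw [mul_assoc]; exact h1

lemma Pol.exists_replace {C : LangClass A} {L : Lang A} (hL : Pol C L) :
    ∃ S : Set (Lang A), S.Finite ∧ S ⊆ C ∧ ∃ N : ℕ, ∀ z u v : FreeMonoid A, Replaceable S u v →
      ∀ x y, x * (z * u) ^ N * y ∈ L →
        ∃ i j : ℕ, x * (z * u) ^ i * z * v * (z * u) ^ j * y ∈ L := by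
  induction hL with
  | @base L hL =>
    refine ⟨{L}, Set.finite_singleton _, by simpa using hL, 1, fun z u v h x y hw => ⟨0, 0, ?_⟩⟩
    have := h L rfl (x * z) y (by simpa [mul_assoc] using hw)
    simpa [mul_assoc] using this
  | @union K L _ _ ihK ihL =>
    obtain ⟨S, hS, hSC, m, hK⟩ := ihK
    obtain ⟨T, hT, hTC, n, hL⟩ := ihL
    refine ⟨S ∪ T, hS.union hT, Set.union_subset hSC hTC, m + n, fun z u v h x y hw => ?_⟩
    rcases hw with hw | hw
    · obtain ⟨i, j, hij⟩ := hK z u v (fun R hR => h R (Or.inl hR)) x ((z * u) ^ n * y)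
        (by simpa only [pow_add, mul_assoc] using hw)
      exact ⟨i, j + n, Or.inl (by simpa only [pow_add, mul_assoc] using hij)⟩
    · obtain ⟨i, j, hij⟩ := hL z u v (fun R hR => h R (Or.inr hR)) (x * (z * u) ^ m) y
        (by simpa only [pow_add, mul_assoc] using hw)
      exact ⟨m + i, j, Or.inr (by simpa only [pow_add, mul_assoc] using hij)⟩
  | @mcat K L a _ _ ihK ihL =>
    obtain ⟨S, hS, hSC, m, hK⟩ := ihK
    obtain ⟨T, hT, hTC, n, hL⟩ := ihL
    refine ⟨S ∪ T, hS.union hT, Set.union_subset hSC hTC, m + n, fun z u v h x y hw => ?_⟩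
    obtain ⟨p, hp, q, hq, hpq⟩ := hw
    rcases factor_before_or_after hpq with ⟨p', rfl, h2⟩ | ⟨q', rfl, h2⟩
    · obtain ⟨i, j, hij⟩ := hK z u v (fun R hR => h R (Or.inl hR)) x p' hp
      refine ⟨i, j + n, _, hij, q, hq, ?_⟩
      simp only [pow_add, mul_assoc] at h2 ⊢
      rw [h2]
    · obtain ⟨i, j, hij⟩ := hL z u v (fun R hR => h R (Or.inr hR)) q' y hq
      refine ⟨m + i, j, p, hp, _, hij, ?_⟩
      simp only [pow_add, ← mul_assoc] at h2 ⊢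
      rw [h2]

/-! ### Pairs and the canonical preorder -/

/-- The two-sided quotients of a regular language form a finite family. -/
lemma IsRegularLang.finite_quotients {K : Lang A} (hK : IsRegularLang K) :
    (Set.range fun p : FreeMonoid A × FreeMonoid A => {w | p.1 * w * p.2 ∈ K}).Finite := by
  obtain ⟨N, _, _, φ, F, rfl⟩ := hK
  refine (Set.finite_range fun p : N × N => {w : FreeMonoid A | p.1 * φ w * p.2 ∈ F}).subset ?_
  rintro _ ⟨p, rfl⟩
  exact ⟨(φ p.1, φ p.2), by ext w; simp⟩

lemma QuotientClosed.two_sided {C : LangClass A} (hC : QuotientClosed C) {K : Lang A}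
    (hK : K ∈ C) (x y : FreeMonoid A) : {w | x * w * y ∈ K} ∈ C :=
  (hC _ (hC K hK y).2 x).1

lemma CPair.exists_replaceable {C : LangClass A} (hC : IsPositivePrevariety C) {M : Type}
    [Monoid M] {α : FreeMonoid A →* M} {s t : M} (hst : CPair C α s t) {S : Set (Lang A)}
    (hS : S.Finite) (hSC : S ⊆ C) : ∃ u v, α u = s ∧ α v = t ∧ Replaceable S u v := by
  by_contra! hcon
  apply hst
  let T : Set (Lang A) :=
    ⋃ K ∈ S, Set.range fun p : FreeMonoid A × FreeMonoid A => {w | p.1 * w * p.2 ∈ K}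
  have hT : T.Finite := hS.biUnion fun K hK => (hC.2.2 K (hSC hK)).finite_quotients
  have hTC : T ⊆ C := by
    refine Set.iUnion₂_subset fun K hK => ?_
    rintro _ ⟨p, rfl⟩
    exact hC.2.1.two_sided (hSC hK) p.1 p.2
  let Q : FreeMonoid A → Lang A := fun u => ⋂₀ {K ∈ T | u ∈ K}
  have hQ : (Set.range Q).Finite := by
    refine (hT.finite_subsets.image Set.sInter).subset ?_
    rintro _ ⟨u, rfl⟩
    exact ⟨_, fun K hK => hK.1, rfl⟩
  have hQC : ∀ u, Q u ∈ C := fun u =>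
    hC.1.sInter_mem (hT.subset fun K hK => hK.1) fun K hK => hTC hK.1
  refine ⟨⋃₀ (Q '' (α ⁻¹' {s})), hC.1.sUnion_mem (hQ.subset (Set.image_subset_range _ _)) ?_,
    ?_, ?_⟩
  · rintro _ ⟨u, -, rfl⟩
    exact hQC u
  · intro u hu
    exact ⟨Q u, ⟨u, hu, rfl⟩, fun K hK => hK.2⟩
  · rw [Set.eq_empty_iff_forall_notMem]
    rintro v ⟨⟨_, ⟨u, hu, rfl⟩, hvQ⟩, hv⟩
    refine hcon u v hu hv fun K hK x y hxuy => ?_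
    exact hvQ {w | x * w * y ∈ K} ⟨Set.mem_biUnion hK ⟨(x, y), rfl⟩, hxuy⟩

section Preorder

variable {C : LangClass A} {M : Type} [Monoid M] {α : FreeMonoid A →* M}

lemma CPair.cPreorder {s t : M} (h : CPair C α s t) : CPreorder C α s t := by
  intro F hF hs
  by_contra ht
  refine h ⟨_, hF, fun w hw => ?_, ?_⟩
  · rw [Set.mem_preimage, show α w = s from hw]
    exact hs
  · rw [Set.eq_empty_iff_forall_notMem]
    rintro w ⟨hw, hwt⟩
    rw [Set.mem_preimage, show α w = t from hwt] at hw
    exact ht hw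

lemma CPair.mul_mul (hC : QuotientClosed C) (hα : Function.Surjective α) {s t : M}
    (h : CPair C α s t) (p q : M) : CPair C α (p * s * q) (p * t * q) := by
  obtain ⟨x, rfl⟩ := hα p
  obtain ⟨y, rfl⟩ := hα q
  rintro ⟨K, hK, hs, ht⟩
  refine h ⟨_, hC.two_sided hK x y, fun w hw => hs ?_, ?_⟩
  · simp [show α w = s from hw]
  · rw [Set.eq_empty_iff_forall_notMem] at ht ⊢
    rintro w ⟨hw, hwt⟩
    exact ht _ ⟨hw, by simp [show α w = t from hwt]⟩

lemma CPreorder.mul_right (hC : QuotientClosed C) (hα : Function.Surjective α) {s t : M}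
    (h : CPreorder C α s t) (q : M) : CPreorder C α (s * q) (t * q) := by
  obtain ⟨y, rfl⟩ := hα q
  intro F hF hs
  refine h {m | m * α y ∈ F} ?_ hs
  simpa [Set.preimage, Set.mem_ofPred_eq] using (hC _ hF y).2

lemma preimage_upper_mem [Finite M] (hC : IsLatticeClass C) (s : M) :
    α ⁻¹' {t | CPreorder C α s t} ∈ C := by
  have h : α ⁻¹' {t | CPreorder C α s t} =
      ⋂₀ ((fun F : Set M => α ⁻¹' F) '' {F | α ⁻¹' F ∈ C ∧ s ∈ F}) := by
    ext w
    simp only [Set.mem_preimage, Set.mem_ofPred_eq, Set.mem_sInter, Set.forall_mem_image, CPreorder,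
      and_imp]
  rw [h]
  refine hC.sInter_mem (Set.toFinite _) ?_
  rintro _ ⟨F, hF, rfl⟩
  exact hF.1

/-- The canonical preorder is contained in the reflexive transitive closure of the pair relation. -/
lemma CPreorder.reflTransGen [Finite M] (hC : IsLatticeClass C) {s t : M}
    (h : CPreorder C α s t) : Relation.ReflTransGen (CPair C α) s t := by
  let F : Set M := {t | Relation.ReflTransGen (CPair C α) s t}
  refine h F ?_ .refl
  have hsep : ∀ u v : M, ∃ K : Lang A, u ∈ F → v ∉ F →
      K ∈ C ∧ Separates K (α ⁻¹' {u}) (α ⁻¹' {v}) := by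
    intro u v
    by_cases huv : u ∈ F ∧ v ∉ F
    · have hs : Separable C (α ⁻¹' {u}) (α ⁻¹' {v}) := by
        by_contra hp
        exact huv.2 (huv.1.tail hp)
      obtain ⟨K, hK, hs⟩ := hs
      exact ⟨K, fun _ _ => ⟨hK, hs⟩⟩
    · exact ⟨∅, fun h1 h2 => absurd ⟨h1, h2⟩ huv⟩
  choose K hK using hsep
  have hF : α ⁻¹' F = ⋃₀ ((fun u => ⋂₀ (K u '' Fᶜ)) '' F) := by
    ext w
    constructor
    · intro hw
      refine ⟨_, ⟨α w, hw, rfl⟩, ?_⟩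
      rintro _ ⟨v, hv, rfl⟩
      exact (hK _ v hw hv).2.1 rfl
    · rintro ⟨_, ⟨u, hu, rfl⟩, hw⟩
      by_contra hv
      exact Set.eq_empty_iff_forall_notMem.1 (hK u (α w) hu hv).2.2 w ⟨hw _ ⟨α w, hv, rfl⟩, rfl⟩
  rw [hF]
  refine hC.sUnion_mem (Set.toFinite _) ?_
  rintro _ ⟨u, hu, rfl⟩
  refine hC.sInter_mem (Set.toFinite _) ?_
  rintro _ ⟨v, hv, rfl⟩
  exact (hK u v hu hv).1

end Preorder

/-! ### Finite monoids -/

section FiniteMonoid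

variable {M : Type} [Monoid M] [Finite M]

lemma exists_eq_mul_right {p s x y : M} (h : p = x * (p * s) * y) : ∃ v, p = p * s * v := by
  have hn : ∀ n : ℕ, p = x ^ n * p * (s * y) ^ n := by
    intro n
    induction n with
    | zero => simp
    | succ n ih =>
      calc p = x ^ n * p * (s * y) ^ n := ih
        _ = x ^ n * (x * (p * s) * y) * (s * y) ^ n := by rw [← h]
        _ = x ^ (n + 1) * p * (s * y) ^ (n + 1) := by
          rw [pow_succ, pow_succ']; simp only [mul_assoc]
  obtain ⟨i, j, hij, hp⟩ := Set.finite_univ.exists_lt_map_eq_of_forall_mem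
    (f := fun n : ℕ => p * (s * y) ^ n) (fun _ => Set.mem_univ _)
  obtain ⟨k, rfl⟩ := Nat.exists_eq_add_of_lt hij
  refine ⟨y * (s * y) ^ k, ?_⟩
  have hcomm : (s * y) ^ (i + k + 1) = (s * y) ^ (k + 1) * (s * y) ^ i := by
    rw [← pow_add]; congr 1; omega
  calc p = x ^ i * p * (s * y) ^ i := hn i
    _ = x ^ i * p * (s * y) ^ (i + k + 1) := by simpa only [mul_assoc] using congrArg (x ^ i * ·) hp
    _ = x ^ i * p * (s * y) ^ i * (s * y) ^ (k + 1) := by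
      rw [mul_assoc _ ((s * y) ^ i), ← pow_add, add_assoc]
    _ = p * s * (y * (s * y) ^ k) := by rw [← hn i, pow_succ']; simp only [mul_assoc]

lemma exists_eq_mul_left {p s x y : M} (h : s = x * (p * s) * y) : ∃ z, s = z * (p * s) := by
  have : Finite Mᵐᵒᵖ := Finite.of_equiv M MulOpposite.opEquiv
  obtain ⟨v, hv⟩ := exists_eq_mul_right (M := Mᵐᵒᵖ) (p := .op s) (s := .op p) (x := .op y)
    (y := .op x) (MulOpposite.unop_injective (by simpa [mul_assoc] using h))
  exact ⟨v.unop, by simpa using congrArg MulOpposite.unop hv⟩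

end FiniteMonoid

section Equation

variable {C : LangClass A} {M : Type} [Monoid M] [Finite M] {α : FreeMonoid A →* M}

lemma CPreorder.eq_of_dvd_one (hC : QuotientClosed C) (hα : Function.Surjective α)
    (heq : ∀ s t : M, CPreorder C α s t → ∀ e, IsIdempotentPower s e → e * s = e * t * e)
    {s t x y : M} (h : 1 = x * s * y) (hst : CPreorder C α s t) : t = s := by
  obtain ⟨v, hv⟩ := exists_eq_mul_right (p := 1) (s := s) (x := x) (y := y) (by simpa using h)
  obtain ⟨z, hz⟩ := exists_eq_mul_left (p := s) (s := 1) (x := x) (y := y) (by simpa using h)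
  simp only [one_mul, mul_one] at hv hz
  have hvs : v * s = 1 := by
    rw [show v = z by rw [← one_mul v, hz, mul_assoc, ← hv, mul_one], ← hz]
  have htv := heq _ _ (hst.mul_right hC hα v) 1 ⟨IsIdempotentElem.one, 1, le_rfl, by simp [← hv]⟩
  simp only [one_mul, mul_one, ← hv] at htv
  rw [← mul_one t, ← hvs, ← mul_assoc, ← htv, one_mul]

/-- If `p`, `s`, `r` all lie in the two-sided ideal generated by `p * s * r`, the middle factor
can be replaced by any larger element. -/
lemma CPreorder.mul_mul_eq (hC : QuotientClosed C) (hα : Function.Surjective α)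
    (heq : ∀ s t : M, CPreorder C α s t → ∀ e, IsIdempotentPower s e → e * s = e * t * e)
    {p s r t : M} (hp : ∃ x y, p = x * (p * s * r) * y) (hs : ∃ x y, s = x * (p * s * r) * y)
    (hr : ∃ x y, r = x * (p * s * r) * y) (hst : CPreorder C α s t) :
    p * t * r = p * s * r := by
  obtain ⟨x₁, y₁, hp⟩ := hp
  obtain ⟨x₂, y₂, hs⟩ := hs
  obtain ⟨x₃, y₃, hr⟩ := hr
  obtain ⟨v, hv⟩ := exists_eq_mul_right (p := p) (s := s) (x := x₁) (y := r * y₁)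
    (by simpa only [mul_assoc] using hp)
  obtain ⟨z, hz⟩ := exists_eq_mul_left (p := p) (s := s) (x := x₂) (y := r * y₂)
    (by simpa only [mul_assoc] using hs)
  obtain ⟨z', hz'⟩ := exists_eq_mul_left (p := s) (s := r) (x := x₃ * p) (y := y₃)
    (by simpa only [mul_assoc] using hr)
  obtain ⟨v', hv'⟩ := exists_eq_mul_right (p := s) (s := r) (x := x₂ * p) (y := y₂)
    (by simpa only [mul_assoc] using hs)
  have h_left : s * v * s = s := by
    have h1 : z * p = s * v := by
      calc z * p = z * (p * s * v) := by rw [← hv]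
        _ = z * (p * s) * v := by simp only [mul_assoc]
        _ = s * v := by rw [← hz]
    rw [← h1, mul_assoc, ← hz]
  have h_right : s * (z' * s) = s := by
    have h1 : z' * s = r * v' := by
      calc z' * s = z' * (s * r * v') := by rw [← hv']
        _ = z' * (s * r) * v' := by simp only [mul_assoc]
        _ = r * v' := by rw [← hz']
    rw [h1, ← mul_assoc, ← hv']
  have h_prod : s * (z' * s * v) = s * v := by rw [← mul_assoc, h_right]
  have h_idem : IsIdempotentElem (s * v) := by
    rw [IsIdempotentElem, ← mul_assoc, h_left]
  have h_mid := heq _ _ (hst.mul_right hC hα (z' * s * v)) (s * v)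
    ⟨h_idem, 1, le_rfl, by rw [h_prod, pow_one]⟩
  rw [h_prod, h_idem] at h_mid
  have h_s : s = s * v * t * z' * s := by
    calc s = s * v * s := h_left.symm
      _ = s * v * (t * (z' * s * v)) * (s * v) * s := by rw [← h_mid]
      _ = s * v * t * z' * (s * v * (s * v * s)) := by simp only [mul_assoc]
      _ = s * v * t * z' * s := by rw [h_left, h_left]
  calc p * t * r = p * s * v * t * (z' * (s * r)) := by rw [← hv, ← hz']
    _ = p * (s * v * t * z' * s) * r := by simp only [mul_assoc]
    _ = p * s * r := by rw [← h_s]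

end Equation

/-! ### Splitting words -/

lemma exists_first_crossing {P : FreeMonoid A → Prop} {w : FreeMonoid A} (h1 : ¬ P 1)
    (hw : P w) : ∃ u a y, w = u * FreeMonoid.of a * y ∧ ¬ P u ∧ P (u * FreeMonoid.of a) := by
  induction w using FreeMonoid.inductionOn' generalizing P with
  | one => exact absurd hw h1
  | of_mul b w ih =>
    by_cases hb : P (FreeMonoid.of b)
    · exact ⟨1, b, w, by simp, h1, by simpa using hb⟩
    · obtain ⟨u, a, y, rfl, hu, hua⟩ :=
        ih (P := fun u => P (FreeMonoid.of b * u)) (by simpa using hb) hw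
      exact ⟨FreeMonoid.of b * u, a, y, by simp only [mul_assoc], hu, by rwa [mul_assoc]⟩

lemma exists_last_crossing {P : FreeMonoid A → Prop} {w : FreeMonoid A} (h1 : ¬ P 1)
    (hw : P w) : ∃ x a v, w = x * FreeMonoid.of a * v ∧ ¬ P v ∧ P (FreeMonoid.of a * v) := by
  induction w using FreeMonoid.inductionOn' with
  | one => exact absurd hw h1
  | of_mul b w ih =>
    by_cases hb : P w
    · obtain ⟨x, a, v, rfl, hv, hav⟩ := ih hb
      exact ⟨FreeMonoid.of b * x, a, v, by simp only [mul_assoc], hv, hav⟩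
    · exact ⟨1, b, w, by simp, hb, hw⟩

/-! ### The two implications -/

section Main

variable {C : LangClass A} {M : Type} [Monoid M] {α : FreeMonoid A →* M}

lemma eq_of_cPair_of_pol (hC : IsPositivePrevariety C)
    (hpol : ∀ F : Set M, Pol C (α ⁻¹' F)) {s t e : M} (hst : CPair C α s t)
    (he : IsIdempotentPower s e) : e * s = e * t * e := by
  obtain ⟨hidem, n, hn, rfl⟩ := he
  obtain ⟨m, rfl⟩ := Nat.exists_eq_add_of_le' hn
  obtain ⟨S, hS, hSC, N, hN⟩ := (hpol {s ^ (m + 1) * s}).exists_replace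
  obtain ⟨u, v, rfl, rfl, huv⟩ := hst.exists_replaceable hC hS hSC
  set e := α u ^ (m + 1) with he
  have hem : α u * α u ^ m = e := by rw [he, pow_succ']
  have hme : α u ^ m * α u = e := by rw [he, pow_succ]
  have hcomm : α u * e = e * α u := by rw [he, ← pow_succ, ← pow_succ']
  have hpow : ∀ i, e * e ^ i = e := fun i => by rw [← pow_succ', hidem.pow_succ_eq]
  have hpow' : ∀ i, e ^ i * e = e := fun i => by rw [← pow_succ, hidem.pow_succ_eq]
  obtain ⟨i, j, hij⟩ := hN (u ^ m) u v huv (u * u ^ (m + 1)) (u ^ (m + 1)) (by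
    simp only [Set.mem_preimage, Set.mem_singleton_iff, map_mul, map_pow, hme, ← he]
    rw [mul_assoc, hpow', mul_assoc, hidem, hcomm])
  simp only [Set.mem_preimage, Set.mem_singleton_iff, map_mul, map_pow, hme, ← he] at hij
  rw [mul_assoc _ (e ^ j), hpow', mul_assoc (α u), hpow, hcomm, mul_assoc e, hem, hidem] at hij
  exact hij.symm

variable [Finite M]

lemma eq_of_cPreorder_of_cPair (hC : IsPositivePrevariety C) (hα : Function.Surjective α)
    (heq : ∀ s t : M, CPair C α s t → ∀ e, IsIdempotentPower s e → e * s = e * t * e)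
    {s t e : M} (hst : CPreorder C α s t) (he : IsIdempotentPower s e) :
    e * s = e * t * e := by
  have hchain := hst.reflTransGen hC.1
  clear hst
  induction hchain with
  | refl =>
    obtain ⟨hidem, n, -, rfl⟩ := he
    rw [mul_assoc, ← pow_succ', pow_succ, ← mul_assoc, hidem]
  | @tail t₁ t₂ _ h ih =>
    obtain ⟨hidem, n, hn, rfl⟩ := he
    have hp := h.mul_mul hC.2.1 hα (s ^ n) (s ^ n)
    rw [← ih] at hp
    have hes : s ^ n = (s ^ n * s) ^ n := by
      obtain ⟨m, rfl⟩ := Nat.exists_eq_add_of_le' hn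
      rw [((Commute.refl s).pow_left _).mul_pow, hidem.pow_succ_eq, hidem]
    have := heq _ _ hp (s ^ n) ⟨hidem, n, hn, hes⟩
    rw [← mul_assoc, hidem] at this
    rw [this, mul_assoc (s ^ n), mul_assoc _ (s ^ n), hidem, ← mul_assoc, ← mul_assoc, hidem]

lemma pol_preimage_singleton [Finite A] (hC : IsPositivePrevariety C)
    (hα : Function.Surjective α)
    (heq : ∀ s t : M, CPreorder C α s t → ∀ e, IsIdempotentPower s e → e * s = e * t * e)
    (s : M) : Pol C (α ⁻¹' {s}) := by
  let r : M → M → Prop := fun s' s => (∃ x y, s = x * s' * y) ∧ ¬ ∃ x y, s' = x * s * y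
  have : IsTrans M r := by
    refine ⟨?_⟩
    rintro a b c ⟨⟨x, y, rfl⟩, h⟩ ⟨⟨x', y', rfl⟩, h'⟩
    refine ⟨⟨x' * x, y * y', by simp only [mul_assoc]⟩, ?_⟩
    rintro ⟨p, q, hpq⟩
    exact h ⟨p * x', y' * q, by simpa only [mul_assoc] using hpq⟩
  have : Std.Irrefl r := ⟨fun a h => h.2 h.1⟩
  induction s using (Finite.wellFounded_of_trans_of_irrefl r).induction with
  | _ s ih =>
  let D : M → Prop := fun m => ∃ x y, m = x * s * y
  by_cases h_one : D 1
  · obtain ⟨x, y, hxy⟩ := h_one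
    have hs : {t | CPreorder C α s t} = {s} := by
      ext t
      refine ⟨fun ht => CPreorder.eq_of_dvd_one hC.2.1 hα heq hxy ht, ?_⟩
      rintro rfl F - ht
      exact ht
    rw [← hs]
    exact Pol.base (preimage_upper_mem hC.1 s)
  let U : Set (Lang A) :=
    Set.range (fun m => α ⁻¹' {m}) ∪ Set.range (fun m => α ⁻¹' {t | CPreorder C α m t})
  have hU : U.Finite := (Set.finite_range _).union (Set.finite_range _)
  let V : Set (Lang A) := (fun k : Lang A × A × Lang A => MarkedCat k.1 k.2.1 k.2.2) ''
    (U ×ˢ Set.univ ×ˢ U)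
  have hV : V.Finite := (hU.prod (Set.finite_univ.prod hU)).image _
  let W : Set (Lang A) := (fun k : Lang A × A × Lang A => MarkedCat k.1 k.2.1 k.2.2) ''
    (U ×ˢ Set.univ ×ˢ V)
  have hW : W.Finite := (hU.prod (Set.finite_univ.prod hV)).image _
  have hUm : ∀ m, α ⁻¹' {m} ∈ U := fun m => Or.inl ⟨m, rfl⟩
  refine Pol.of_finite_cover hC.1 (hV.union hW) fun w hw => ?_
  have hDw : D (α w) := ⟨1, 1, by rw [show α w = s from hw]; simp⟩
  obtain ⟨u, a, y, rfl, hu, hua⟩ := exists_first_crossing (P := fun w => D (α w))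
    (by simpa using h_one) hDw
  have hw' : α u * α (FreeMonoid.of a) * α y = s := by simpa using hw
  have hu_pol : Pol C (α ⁻¹' {α u}) :=
    ih _ ⟨⟨1, α (FreeMonoid.of a) * α y, by rw [← hw']; simp only [mul_assoc, one_mul]⟩, hu⟩
  by_cases hy : D (α y)
  · obtain ⟨x, b, v, rfl, hv, hbv⟩ := exists_last_crossing (P := fun w => D (α w))
      (by simpa using h_one) hy
    have hw'' : α u * α (FreeMonoid.of a) * α x * (α (FreeMonoid.of b) * α v) = s := by
      rw [← hw']; simp only [map_mul, mul_assoc]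
    have hv_pol : Pol C (α ⁻¹' {α v}) :=
      ih _ ⟨⟨α u * α (FreeMonoid.of a) * α x * α (FreeMonoid.of b), 1,
        by rw [← hw'']; simp only [mul_assoc, mul_one]⟩, hv⟩
    suffices hX : ∃ X ∈ U, Pol C X ∧ x ∈ X ∧ ∀ x' ∈ X,
        α u * α (FreeMonoid.of a) * α x' * (α (FreeMonoid.of b) * α v) = s by
      obtain ⟨X, hXU, hXpol, hxX, hX⟩ := hX
      refine ⟨MarkedCat (α ⁻¹' {α u}) a (MarkedCat X b (α ⁻¹' {α v})),
        Or.inr ⟨(_, a, _), ⟨hUm _, Set.mem_univ _, ⟨(X, b, _), ⟨hXU, Set.mem_univ _, hUm _⟩, rfl⟩⟩,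
          rfl⟩, hu_pol.mcat a (hXpol.mcat b hv_pol), ⟨u, rfl, _, ⟨x, hxX, v, rfl, rfl⟩, rfl⟩, ?_⟩
      rintro _ ⟨u', hu', _, ⟨x', hx', v', hv', rfl⟩, rfl⟩
      rw [Set.mem_preimage, Set.mem_singleton_iff] at hu' hv' ⊢
      simpa only [map_mul, hu', hv', mul_assoc] using hX x' hx'
    by_cases hx : D (α x)
    · refine ⟨α ⁻¹' {t | CPreorder C α (α x) t}, Or.inr ⟨α x, rfl⟩,
        Pol.base (preimage_upper_mem hC.1 _), fun F _ h => h, fun x' hx' => ?_⟩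
      rw [map_mul] at hua hbv
      simp only [D, ← hw''] at hua hbv hx
      exact (CPreorder.mul_mul_eq hC.2.1 hα heq hua hx hbv hx').trans hw''
    · refine ⟨α ⁻¹' {α x}, hUm _, ih _ ⟨⟨_, _, hw''.symm⟩, hx⟩, rfl, fun x' hx' => ?_⟩
      rw [show α x' = α x from hx', hw'']
  · have hy_pol : Pol C (α ⁻¹' {α y}) :=
      ih _ ⟨⟨α u * α (FreeMonoid.of a), 1, by rw [← hw', mul_one]⟩, hy⟩
    refine ⟨MarkedCat (α ⁻¹' {α u}) a (α ⁻¹' {α y}),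
      Or.inl ⟨(_, a, _), ⟨hUm _, Set.mem_univ _, hUm _⟩, rfl⟩, hu_pol.mcat a hy_pol,
      ⟨u, rfl, y, rfl, rfl⟩, ?_⟩
    rintro _ ⟨u', hu', y', hy', rfl⟩
    rw [Set.mem_preimage, Set.mem_singleton_iff] at hu' hy' ⊢
    rw [map_mul, map_mul, hu', hy', hw']

lemma pol_preimage [Finite A] (hC : IsPositivePrevariety C) (hα : Function.Surjective α)
    (heq : ∀ s t : M, CPreorder C α s t → ∀ e, IsIdempotentPower s e → e * s = e * t * e)
    (F : Set M) : Pol C (α ⁻¹' F) := by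
  refine Pol.of_finite_cover hC.1 (Set.finite_range fun m : M => α ⁻¹' {m}) fun w hw =>
    ⟨α ⁻¹' {α w}, ⟨α w, rfl⟩, pol_preimage_singleton hC hα heq _, rfl, fun w' hw' => ?_⟩
  rw [Set.mem_preimage, show α w' = α w from hw']
  exact hw

end Main

/-- characterization of `(Pol C ∩ coPol C)`-morphisms for a positive
prevariety `C`. -/
theorem capol_morphism_tfae {A : Type} [Fintype A] (C : LangClass A)
    (hC : IsPositivePrevariety C) {M : Type} [Monoid M] [Finite M]
    (α : FreeMonoid A →* M) (hsurj : Function.Surjective α) :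
    [(∀ F : Set M, Pol C (α ⁻¹' F) ∧ α ⁻¹' F ∈ coPol C),
     (∀ s t : M, CPair C α s t →
       ∀ e : M, IsIdempotentPower s e → e * s = e * t * e),
     (∀ s t : M, CPreorder C α s t →
       ∀ e : M, IsIdempotentPower s e → e * s = e * t * e)].TFAE := by
  tfae_have 1 → 2 := fun h s t hst e he => eq_of_cPair_of_pol hC (fun F => (h F).1) hst he
  tfae_have 2 → 3 := fun h s t hst e he => eq_of_cPreorder_of_cPair hC hsurj h hst he
  tfae_have 3 → 1 := fun h F => ⟨pol_preimage hC hsurj h F, α ⁻¹' Fᶜ, pol_preimage hC hsurj h Fᶜ, by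
    rw [← Set.preimage_compl, compl_compl]⟩
  tfae_finish

end RegLang
end

section
/- Let C be a prevariety of languages over a finite alphabet A and let L ∈ UPol(C). Then there exist a C-morphism η : A* → N into a finite monoid N and a natural number k such that for all words u, v, v', x, y, if η(u) = η(v) = η(v'), then x u^k v u^k y ∈ L if and only if x u^k v' u^k y ∈ L. -/
/- Common definitions: languages over a finite alphabet, classes of languages,
prevarieties, polynomial closure and its variants, separation, C-pairs, etc. -/

namespace RegLang

variable {A : Type}

/-- Membership in `L` is unaffected by replacing `v` with `v'` inside `u ^ k * v * u ^ k`
when `u`, `v` and `v'` have the same image under `η`. -/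
def SwapInvariant {N : Type} [Monoid N] (η : FreeMonoid A →* N) (k : ℕ) (L : Lang A) : Prop :=
  ∀ u v v' x y : FreeMonoid A, η u = η v → η u = η v' →
    (x * u ^ k * v * u ^ k * y ∈ L ↔ x * u ^ k * v' * u ^ k * y ∈ L)

lemma SwapInvariant.mono {N : Type} [Monoid N] {η : FreeMonoid A →* N} {k l : ℕ} {L : Lang A}
    (h : SwapInvariant η k L) (hkl : k ≤ l) : SwapInvariant η l L := by
  obtain ⟨d, rfl⟩ := Nat.exists_eq_add_of_le hkl
  intro u v v' x y hv hv'
  have := h u v v' (x * u ^ d) (u ^ d * y) hv hv'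
  have e : ∀ t : FreeMonoid A, x * u ^ (k + d) * t * u ^ (k + d) * y =
      x * u ^ d * u ^ k * t * u ^ k * (u ^ d * y) := by
    intro t
    conv_lhs => rw [pow_add u k d]
    conv_lhs => enter [1, 1, 1]; rw [← pow_add, add_comm, pow_add]
    simp only [mul_assoc]
  rwa [e, e]

lemma SwapInvariant.refine {N N' : Type} [Monoid N] [Monoid N'] {η : FreeMonoid A →* N}
    {θ : FreeMonoid A →* N'} {k : ℕ} {L : Lang A} (h : SwapInvariant η k L)
    (hθ : ∀ u v, θ u = θ v → η u = η v) : SwapInvariant θ k L :=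
  fun u v v' x y hv hv' => h u v v' x y (hθ _ _ hv) (hθ _ _ hv')

lemma IsBooleanAlgebraClass.iInter_mem {C : LangClass A} (hC : IsBooleanAlgebraClass C)
    {ι : Type} [Finite ι] {f : ι → Lang A} (hf : ∀ i, f i ∈ C) : ⋂ i, f i ∈ C := by
  classical
  cases nonempty_fintype ι
  have : ∀ s : Finset ι, ⋂ i ∈ s, f i ∈ C := by
    intro s
    induction s using Finset.induction_on with
    | empty => simpa using hC.1.2.1
    | insert a s _ ih =>
      rw [Finset.set_biInter_insert]
      exact hC.1.2.2.2 _ _ (hf a) ih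
  simpa using this Finset.univ

lemma IsBooleanAlgebraClass.iUnion_mem {C : LangClass A} (hC : IsBooleanAlgebraClass C)
    {ι : Type} [Finite ι] {f : ι → Lang A} (hf : ∀ i, f i ∈ C) : ⋃ i, f i ∈ C := by
  rw [← compl_compl (⋃ i, f i), Set.compl_iUnion]
  exact hC.2 _ (hC.iInter_mem fun i => hC.2 _ (hf i))

lemma isCMorphism_of_singleton {C : LangClass A} (hC : IsBooleanAlgebraClass C)
    {N : Type} [Monoid N] [Finite N] {η : FreeMonoid A →* N} (hη : Function.Surjective η)
    (h : ∀ w, {v | η v = η w} ∈ C) : IsCMorphism C η := by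
  refine ⟨hη, fun F => ?_⟩
  have : η ⁻¹' F = ⋃ s : F, {v | η v = s} := by
    ext v
    simp
  rw [this]
  refine hC.iUnion_mem fun s => ?_
  obtain ⟨w, hw⟩ := hη s
  rw [← hw]
  exact h w

lemma exists_isCMorphism_refining_pair {C : LangClass A} (hC : IsBooleanAlgebraClass C)
    {N₁ N₂ : Type} [Monoid N₁] [Monoid N₂] [Finite N₁] [Finite N₂]
    {η₁ : FreeMonoid A →* N₁} {η₂ : FreeMonoid A →* N₂}
    (h₁ : IsCMorphism C η₁) (h₂ : IsCMorphism C η₂) :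
    ∃ (N : Type) (_ : Monoid N) (_ : Finite N) (η : FreeMonoid A →* N), IsCMorphism C η ∧
      ∀ u v, η u = η v → η₁ u = η₁ v ∧ η₂ u = η₂ v := by
  have key : ∀ u v, (η₁.prod η₂).mrangeRestrict u = (η₁.prod η₂).mrangeRestrict v ↔
      η₁ u = η₁ v ∧ η₂ u = η₂ v := fun u v => by simp [Subtype.ext_iff]
  refine ⟨MonoidHom.mrange (η₁.prod η₂), inferInstance, inferInstance,
    (η₁.prod η₂).mrangeRestrict,
    isCMorphism_of_singleton hC (MonoidHom.mrangeRestrict_surjective _) fun w => ?_,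
    fun u v h => (key u v).1 h⟩
  simp only [key]
  exact hC.1.2.2.2 _ _ (h₁.2 {η₁ w}) (h₂.2 {η₂ w})

/-- The syntactic congruence of a language. -/
def syntacticCon (L : Lang A) : Con (FreeMonoid A) where
  r u v := ∀ x y, x * u * y ∈ L ↔ x * v * y ∈ L
  iseqv := ⟨fun _ _ _ => Iff.rfl, fun h x y => (h x y).symm,
    fun h h' x y => (h x y).trans (h' x y)⟩
  mul' {u u' v v'} h h' x y := by
    have h₁ := h x (v * y)
    have h₂ := h' (x * u') y
    simp only [mul_assoc] at h₁ h₂ ⊢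
    exact h₁.trans h₂

lemma syntacticCon_of_map_eq {M : Type} [Monoid M] (φ : FreeMonoid A →* M) (F : Set M)
    {u v : FreeMonoid A} (h : φ u = φ v) : syntacticCon (φ ⁻¹' F) u v :=
  fun x y => by simp [h]

lemma exists_isCMorphism_recognizing {C : LangClass A} (hC : IsPrevariety C) {L : Lang A}
    (hL : L ∈ C) :
    ∃ (N : Type) (_ : Monoid N) (_ : Finite N) (η : FreeMonoid A →* N), IsCMorphism C η ∧
      ∀ u v, η u = η v → ∀ x y, x * u * y ∈ L ↔ x * v * y ∈ L := by
  obtain ⟨hB, hQ, hR⟩ := hC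
  obtain ⟨M, _, _, φ, F, hF⟩ := hR L hL
  have hfin : Finite (syntacticCon L).Quotient := by
    refine Finite.of_injective (fun q : (syntacticCon L).Quotient => φ (Quotient.out q)) ?_
    intro q q' h
    subst hF
    exact (Quotient.out_eq q).symm.trans
      ((Quotient.sound (syntacticCon_of_map_eq φ F h)).trans (Quotient.out_eq q'))
  have key : ∀ u v, (syntacticCon L).mk' u = (syntacticCon L).mk' v ↔
      ∀ x y, x * u * y ∈ L ↔ x * v * y ∈ L := fun u v => Con.eq _
  refine ⟨(syntacticCon L).Quotient, inferInstance, hfin, (syntacticCon L).mk',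
    isCMorphism_of_singleton hB Con.mk'_surjective fun w => ?_, fun u v h => (key u v).1 h⟩
  have hS : ∀ x y : FreeMonoid A, {v | x * v * y ∈ L ↔ x * w * y ∈ L} ∈ C := by
    intro x y
    have h := (hQ _ (hQ L hL y).2 x).1
    by_cases hw : x * w * y ∈ L
    · simpa [hw] using h
    · convert hB.2 _ h using 1
      ext v
      simp [hw]
  have : {v | (syntacticCon L).mk' v = (syntacticCon L).mk' w} =
      ⋂ p : M × M, {v | Function.invFun φ p.1 * v * Function.invFun φ p.2 ∈ L ↔
        Function.invFun φ p.1 * w * Function.invFun φ p.2 ∈ L} := by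
    ext v
    simp only [key, Set.mem_ofPred_eq, Set.mem_iInter]
    refine ⟨fun h p => h _ _, fun h x y => ?_⟩
    have h' := h (φ x, φ y)
    have e : ∀ x, φ (Function.invFun φ (φ x)) = φ x := fun x => Function.invFun_eq ⟨x, rfl⟩
    simpa [hF, e] using h'
  rw [this]
  exact hB.iInter_mem fun p => hS _ _

lemma exists_pow_isIdempotentElem (N : Type*) [Monoid N] [Finite N] :
    ∃ q, 0 < q ∧ ∀ s : N, IsIdempotentElem (s ^ q) := by
  have h : ∀ s : N, ∃ n, 0 < n ∧ IsIdempotentElem (s ^ n) := by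
    intro s
    obtain ⟨i, j, hij, he⟩ : ∃ i j, i < j ∧ s ^ i = s ^ j := by
      obtain ⟨i, j, hne, he⟩ := Finite.exists_ne_map_eq_of_infinite fun n : ℕ => s ^ n
      rcases lt_or_gt_of_ne hne with h | h
      · exact ⟨i, j, h, he⟩
      · exact ⟨j, i, h, he.symm⟩
    obtain ⟨p, rfl⟩ := Nat.exists_eq_add_of_lt hij
    have step : ∀ c d, s ^ (i + d) = s ^ (i + d + c * (p + 1)) := by
      intro c
      induction c with
      | zero => simp
      | succ c ih =>
        intro d
        rw [ih, pow_add, pow_add, he, ← pow_add, ← pow_add]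
        congr 1
        ring
    refine ⟨(i + 1) * (p + 1), by positivity, ?_⟩
    obtain ⟨d, hd⟩ : ∃ d, (i + 1) * (p + 1) = i + d :=
      Nat.exists_eq_add_of_le (by nlinarith)
    rw [IsIdempotentElem, ← pow_add]
    nth_rw 1 [hd]
    rw [← step, ← hd]
  choose n hn hi using h
  cases nonempty_fintype N
  refine ⟨∏ s, n s, Finset.prod_pos fun s _ => hn s, fun s => ?_⟩
  obtain ⟨c, hc⟩ := Finset.dvd_prod_of_mem n (Finset.mem_univ s)
  rw [hc, pow_mul]
  exact (hi s).pow c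

lemma mul_of_mul_eq_mul_mul {w₁ w₂ p v r : FreeMonoid A} {a : A}
    (h : p * v * r = w₁ * FreeMonoid.of a * w₂) :
    (∃ z, p = w₁ * FreeMonoid.of a * z ∧ w₂ = z * v * r) ∨
    (∃ z z', v = z * FreeMonoid.of a * z' ∧ w₁ = p * z ∧ w₂ = z' * r) ∨
    (∃ z, r = z * FreeMonoid.of a * w₂ ∧ w₁ = p * v * z) := by
  have split : ∀ s t w₂ : FreeMonoid A, s * t = w₁ * FreeMonoid.of a * w₂ →
      (∃ z, s = w₁ * FreeMonoid.of a * z ∧ w₂ = z * t) ∨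
      (∃ z, t = z * FreeMonoid.of a * w₂ ∧ w₁ = s * z) := by
    intro s t w₂ hst
    rw [mul_assoc] at hst
    have happ : (∃ z : FreeMonoid A, w₁ = s * z ∧ t = z * (FreeMonoid.of a * w₂)) ∨
        ∃ z : FreeMonoid A, s = w₁ * z ∧ FreeMonoid.of a * w₂ = z * t :=
      List.append_eq_append_iff.1 hst
    rcases happ with ⟨z, hz, hz'⟩ | ⟨z, hz, hz'⟩
    · exact .inr ⟨z, by rw [mul_assoc, hz'], hz⟩
    · have hcons : (z = 1 ∧ t = FreeMonoid.of a * w₂) ∨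
          ∃ z' : FreeMonoid A, z = FreeMonoid.of a * z' ∧ w₂ = z' * t :=
        List.cons_eq_append_iff.1 hz'
      rcases hcons with ⟨rfl, ht⟩ | ⟨z', rfl, ht⟩
      · exact .inr ⟨1, by rw [one_mul, ht], by rw [mul_one, hz, mul_one]⟩
      · exact .inl ⟨z', by rw [mul_assoc, hz], ht⟩
  rcases split _ _ _ h with ⟨z, hz, rfl⟩ | ⟨z, hz, rfl⟩
  · rcases split _ _ _ hz with ⟨z', hz', rfl⟩ | ⟨z', hz', rfl⟩
    · exact .inl ⟨z', hz', rfl⟩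
    · exact .inr (.inl ⟨z', z, hz', rfl, rfl⟩)
  · exact .inr (.inr ⟨z, hz, rfl⟩)

/-- In an unambiguous concatenation the marked letter never lies between two long blocks of
powers of a word with the same idempotent image. -/
lemma Unambiguous.not_mem_block {N : Type} [Monoid N] {η : FreeMonoid A →* N} {k : ℕ}
    {K H : Lang A} {a : A} (hKH : Unambiguous K a H) (hK : SwapInvariant η k K)
    (hH : SwapInvariant η k H) {u z z' x y : FreeMonoid A} (hu : IsIdempotentElem (η u))
    (hv : η u = η (z * FreeMonoid.of a * z')) (hx : x * u ^ (2 * k + 1) * z ∈ K)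
    (hy : z' * u ^ (2 * k + 1) * y ∈ H) : False := by
  set v := z * FreeMonoid.of a * z' with hvdef
  have e₁ : ∀ s t : FreeMonoid A,
      s * u ^ (2 * k + 1) * t = s * u ^ k * u * u ^ k * t := fun s t => by
    rw [two_mul, add_right_comm, pow_add, pow_succ]
    simp only [mul_assoc]
  have e₂ : ∀ s t : FreeMonoid A, s * u ^ k * (u ^ (k + 1) * v * u ^ (k + 1)) * u ^ k * t =
      s * u ^ (2 * k + 1) * v * u ^ (2 * k + 1) * t := fun s t => by
    have h₁ : u ^ (2 * k + 1) = u ^ k * u ^ (k + 1) := by rw [← pow_add]; congr 1; ring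
    have h₂ : u ^ (2 * k + 1) = u ^ (k + 1) * u ^ k := by rw [← pow_add]; congr 1; ring
    conv_rhs => enter [1, 1, 1]; rw [h₁]
    conv_rhs => rw [h₂]
    simp only [mul_assoc]
  have hw : η u = η (u ^ (k + 1) * v * u ^ (k + 1)) := by
    simp only [map_mul, map_pow, ← hv, hu.pow_succ_eq, hu.eq]
  have hx' : x * u ^ (2 * k + 1) * v * u ^ (2 * k + 1) * z ∈ K := by
    rw [← e₂]
    rw [e₁] at hx
    exact (hK u u _ _ _ rfl hw).1 hx
  have hy' : z' * u ^ (2 * k + 1) * v * u ^ (2 * k + 1) * y ∈ H := by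
    rw [← e₂]
    rw [e₁] at hy
    exact (hH u u _ _ _ rfl hw).1 hy
  have := (hKH _ _ _ _ hx hx' hy' hy (by simp only [hvdef, mul_assoc])).1
  have := congrArg FreeMonoid.length this
  simp [hvdef] at this
  omega

lemma SwapInvariant.markedCat {N : Type} [Monoid N] [Finite N] {η : FreeMonoid A →* N} {k : ℕ}
    {K H : Lang A} {a : A} (hKH : Unambiguous K a H) (hK : SwapInvariant η k K)
    (hH : SwapInvariant η k H) : ∃ l, SwapInvariant η l (MarkedCat K a H) := by
  obtain ⟨q, hq, hidem⟩ := exists_pow_isIdempotentElem N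
  obtain ⟨d, hd⟩ : ∃ d, q * (2 * k + 1) = k + d + (k + 1) :=
    ⟨q * (2 * k + 1) - (2 * k + 1), by have := Nat.le_mul_of_pos_left (2 * k + 1) hq; omega⟩
  set m := q * (2 * k + 1) with hm
  refine ⟨m * (2 * k + 1) + m, fun u v v' x y hv hv' => ?_⟩
  suffices imp : ∀ v v' : FreeMonoid A, η u = η v → η u = η v' →
      x * u ^ (m * (2 * k + 1) + m) * v * u ^ (m * (2 * k + 1) + m) * y ∈ MarkedCat K a H →
      x * u ^ (m * (2 * k + 1) + m) * v' * u ^ (m * (2 * k + 1) + m) * y ∈ MarkedCat K a H from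
    ⟨imp v v' hv hv', imp v' v hv' hv⟩
  clear hv hv' v v'
  intro v v' hv hv' hmem
  have e : ∀ t : FreeMonoid A, x * u ^ (m * (2 * k + 1) + m) * t * u ^ (m * (2 * k + 1) + m) * y =
      (x * u ^ (d + (k + 1)) * (u ^ m) ^ (2 * k + 1)) * (u ^ k * t * u ^ (k + d)) *
        ((u ^ m) ^ (2 * k + 1) * (u ^ (k + 1) * y)) := fun t => by
    have h₁ : u ^ (m * (2 * k + 1) + m) =
        u ^ (d + (k + 1)) * (u ^ m) ^ (2 * k + 1) * u ^ k := by
      rw [← pow_mul, ← pow_add, ← pow_add]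
      congr 1
      omega
    have h₂ : u ^ (m * (2 * k + 1) + m) =
        u ^ (k + d) * (u ^ m) ^ (2 * k + 1) * u ^ (k + 1) := by
      rw [← pow_mul, ← pow_add, ← pow_add]
      congr 1
      omega
    conv_lhs => enter [1, 1, 1]; rw [h₁]
    conv_lhs => rw [h₂]
    simp only [mul_assoc]
  rw [e] at hmem ⊢
  set p := x * u ^ (d + (k + 1)) * (u ^ m) ^ (2 * k + 1) with hp
  set r := (u ^ m) ^ (2 * k + 1) * (u ^ (k + 1) * y) with hr
  have swap : ∀ (L : Lang A), SwapInvariant η k L → ∀ s t : FreeMonoid A,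
      s * (u ^ k * v * u ^ (k + d)) * t ∈ L → s * (u ^ k * v' * u ^ (k + d)) * t ∈ L := by
    intro L hL s t
    have := (hL u v v' s (u ^ d * t) hv hv').1
    simpa only [pow_add, mul_assoc] using this
  obtain ⟨w₁, hw₁, w₂, hw₂, h⟩ := hmem
  rcases mul_of_mul_eq_mul_mul h with ⟨z, hz, rfl⟩ | ⟨z, z', hz, rfl, rfl⟩ | ⟨z, hz, rfl⟩
  · exact ⟨w₁, hw₁, _, swap H hH z r hw₂, by rw [hz]; simp only [mul_assoc]⟩
  · refine (hKH.not_mem_block hK hH (u := u ^ m) (z := z) (z' := z')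
      (y := u ^ (k + 1) * y) ?_ ?_ hw₁ ?_).elim
    · rw [map_pow, hm, pow_mul]
      exact (hidem _).pow _
    · rw [← hz, map_mul, map_mul, ← hv]
      simp only [map_pow, ← pow_succ, ← pow_add]
      congr 1
      omega
    · rw [mul_assoc]
      exact hw₂
  · exact ⟨_, swap K hK p z hw₁, w₂, hw₂, by rw [hz]; simp only [mul_assoc]⟩

lemma exists_common_swapInvariant {C : LangClass A} (hC : IsPrevariety C) {K H : Lang A}
    (hK : ∃ (N : Type) (_ : Monoid N) (_ : Finite N) (η : FreeMonoid A →* N) (k : ℕ),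
      IsCMorphism C η ∧ SwapInvariant η k K)
    (hH : ∃ (N : Type) (_ : Monoid N) (_ : Finite N) (η : FreeMonoid A →* N) (k : ℕ),
      IsCMorphism C η ∧ SwapInvariant η k H) :
    ∃ (N : Type) (_ : Monoid N) (_ : Finite N) (η : FreeMonoid A →* N) (k : ℕ),
      IsCMorphism C η ∧ SwapInvariant η k K ∧ SwapInvariant η k H := by
  obtain ⟨N₁, _, _, η₁, k₁, h₁, hK⟩ := hK
  obtain ⟨N₂, _, _, η₂, k₂, h₂, hH⟩ := hH
  obtain ⟨N, _, _, η, hη, href⟩ := exists_isCMorphism_refining_pair hC.1 h₁ h₂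
  exact ⟨N, inferInstance, inferInstance, η, max k₁ k₂, hη,
    (hK.refine fun u v h => (href u v h).1).mono (le_max_left _ _),
    (hH.refine fun u v h => (href u v h).2).mono (le_max_right _ _)⟩

/-- every `L ∈ UPol C` admits a `C`-morphism `η` and a number `k` such
that swapping `η`-equivalent middle factors around `u^k` does not affect membership. -/
theorem upol_exists_cmorphism_pumping {A : Type} [Fintype A] (C : LangClass A)
    (hC : IsPrevariety C) (L : Lang A) (hL : UPol C L) :
    ∃ (N : Type) (_ : Monoid N) (_ : Finite N) (η : FreeMonoid A →* N) (k : ℕ),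
      IsCMorphism C η ∧
        ∀ u v v' x y : FreeMonoid A, η u = η v → η u = η v' →
          (x * u ^ k * v * u ^ k * y ∈ L ↔ x * u ^ k * v' * u ^ k * y ∈ L) := by
  change ∃ (N : Type) (_ : Monoid N) (_ : Finite N) (η : FreeMonoid A →* N) (k : ℕ),
    IsCMorphism C η ∧ SwapInvariant η k L
  induction hL with
  | base hL =>
    obtain ⟨N, _, _, η, hη, h⟩ := exists_isCMorphism_recognizing hC hL
    refine ⟨N, inferInstance, inferInstance, η, 0, hη, fun u v v' x y hv hv' => ?_⟩
    simpa using h v v' (hv.symm.trans hv') x y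
  | disjUnion _ _ _ ihK ihH =>
    obtain ⟨N, _, _, η, k, hη, hK, hH⟩ := exists_common_swapInvariant hC ihK ihH
    exact ⟨N, inferInstance, inferInstance, η, k, hη, fun u v v' x y hv hv' =>
      or_congr (hK u v v' x y hv hv') (hH u v v' x y hv hv')⟩
  | mcat a _ _ hKH ihK ihH =>
    obtain ⟨N, _, _, η, k, hη, hK, hH⟩ := exists_common_swapInvariant hC ihK ihH
    obtain ⟨l, hl⟩ := hK.markedCat hKH hH
    exact ⟨N, inferInstance, inferInstance, η, l, hη, hl⟩

end RegLang
end
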